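/- Let α be a rewb over Σ all of whose number characters are ≤ κ and let v = v₁⋯v_n ∈ Ref(α) with each v_r ∈ Δ. Then for every 0 ≤ i ≤ n, (φ_{v_i}^{open(v₁⋯v_i)} ∘ ⋯ ∘ φ_{v₁}^{open(v₁)})(ε, ε, …, ε) = (deref(v₁⋯v_i), μ₁(v₁⋯v_i), …, μ_κ(v₁⋯v_i)). In particular, for i = n the first component of the resulting (κ+1)-tuple equals deref(v). -/

import Mathlib

namespace Rewbs

/-- Extended alphabet Δ = Σ ⊎ B ⊎ ℕ⁺ : ordinary characters, brackets `[_i`, `]_i`,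
and number characters (references). -/
inductive RSym (A : Type) : Type where
  | ch : A → RSym A
  | open_ : ℕ+ → RSym A
  | close : ℕ+ → RSym A
  | ref : ℕ+ → RSym A

/-- The alphabet Σ ⊎ B (no number characters). -/
inductive BSym (A : Type) : Type where
  | ch : A → BSym A
  | open_ : ℕ+ → BSym A
  | close : ℕ+ → BSym A

/-- The homomorphism g : (Σ ⊎ B)* → Σ* erasing brackets. -/
def projB {A : Type} (v : List (BSym A)) : List A :=
  v.filterMap fun c => match c with
    | .ch a => some a
    | _ => none

/-- The fetching function fet_i. -/
noncomputable def fet {A : Type} (i : ℕ+) (v : List (BSym A)) : List A :=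
  letI : DecidableEq (BSym A) := Classical.decEq _
  if BSym.open_ i ∈ v then
    projB (((v.reverse.takeWhile (fun c => decide (c ≠ BSym.open_ i))).reverse).takeWhile
      (fun c => decide (c ≠ BSym.close i)))
  else []

/-- One step of the pre-dereferencing function (processing one character, appended
at the right of the already-processed string). -/
noncomputable def derefStep {A : Type} (acc : List (BSym A)) : RSym A → List (BSym A)
  | .ch a => acc ++ [BSym.ch a]
  | .open_ i => acc ++ [BSym.open_ i]
  | .close i => acc ++ [BSym.close i]
  | .ref i => acc ++ (fet i acc).map BSym.ch

/-- The pre-dereferencing function D : Δ* → (Σ ⊎ B)*. -/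
noncomputable def preDeref {A : Type} (v : List (RSym A)) : List (BSym A) :=
  v.foldl derefStep []

/-- μ_i = fet_i ∘ D. -/
noncomputable def mu {A : Type} (i : ℕ+) (v : List (RSym A)) : List A :=
  fet i (preDeref v)

/-- deref = g ∘ D. -/
noncomputable def deref {A : Type} (v : List (RSym A)) : List A :=
  projB (preDeref v)

/-- One step of the `open` function. -/
def openStep {A : Type} (s : Finset ℕ+) : RSym A → Finset ℕ+
  | .open_ i => insert i s
  | .close i => s.erase i
  | _ => s

/-- open : Δ* → finite subsets of ℕ⁺. -/
def openSet {A : Type} (v : List (RSym A)) : Finset ℕ+ :=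
  v.foldl openStep ∅

/-- Syntax of regular expressions with backreferences (rewb). -/
inductive Rewb (A : Type) : Type where
  | ch : A → Rewb A
  | eps : Rewb A
  | backref : ℕ+ → Rewb A
  | cat : Rewb A → Rewb A → Rewb A
  | alt : Rewb A → Rewb A → Rewb A
  | star : Rewb A → Rewb A
  | grp : ℕ+ → Rewb A → Rewb A

/-- `hasIdx i α` : the capturing group `(_i )_i` or the reference `\i` occurs in α. -/
def hasIdx {A : Type} (i : ℕ+) : Rewb A → Prop
  | .ch _ => False
  | .eps => False
  | .backref j => j = i
  | .cat r s => hasIdx i r ∨ hasIdx i s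
  | .alt r s => hasIdx i r ∨ hasIdx i s
  | .star r => hasIdx i r
  | .grp j r => j = i ∨ hasIdx i r

/-- Well-formedness of a rewb: in `(_i α)_i`, the body α contains neither the
capturing group `(_i )_i` nor the reference `\i`. -/
def Rewb.WF {A : Type} : Rewb A → Prop
  | .ch _ => True
  | .eps => True
  | .backref _ => True
  | .cat r s => r.WF ∧ s.WF
  | .alt r s => r.WF ∧ s.WF
  | .star r => r.WF
  | .grp i r => r.WF ∧ ¬ hasIdx i r

/-- The ref-language Ref(α) ⊆ Δ*. -/
def Ref {A : Type} : Rewb A → Language (RSym A)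
  | .ch a => {[RSym.ch a]}
  | .eps => 1
  | .backref i => {[RSym.ref i]}
  | .cat r s => Ref r * Ref s
  | .alt r s => Ref r + Ref s
  | .star r => KStar.kstar (Ref r)
  | .grp i r => ({[RSym.open_ i]} : Language (RSym A)) * Ref r * ({[RSym.close i]} : Language (RSym A))

/-- The language of a rewb: L(α) = deref(Ref(α)). -/
noncomputable def rewbLang {A : Type} (r : Rewb A) : Set (List A) :=
  deref '' (Ref r : Set (List (RSym A)))

/-- capt(α): the set of indices guaranteed to be captured. -/
def capt {A : Type} : Rewb A → Set ℕ+
  | .ch _ => ∅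
  | .eps => ∅
  | .backref _ => ∅
  | .cat r s => capt r ∪ capt s
  | .alt r s => capt r ∩ capt s
  | .star r => capt r
  | .grp i r => capt r ∪ {i}

/-- The relation S ⊢ α. -/
def Sat {A : Type} : Rewb A → Set ℕ+ → Prop
  | .ch _, _ => True
  | .eps, _ => True
  | .backref i, S => i ∈ S
  | .cat r s, S => Sat r S ∧ Sat s (S ∪ capt r)
  | .alt r s, S => Sat r S ∧ Sat s S
  | .star r, S => Sat r S
  | .grp _ r, S => Sat r S

/-- A rewb is closed if ∅ ⊢ α. -/
def Rewb.Closed {A : Type} (r : Rewb A) : Prop := Sat r ∅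

/-- A rewb is closed-star if the body of every starred subexpression is closed. -/
def Rewb.ClosedStar {A : Type} : Rewb A → Prop
  | .ch _ => True
  | .eps => True
  | .backref _ => True
  | .cat r s => r.ClosedStar ∧ s.ClosedStar
  | .alt r s => r.ClosedStar ∧ s.ClosedStar
  | .star r => r.ClosedStar ∧ r.Closed
  | .grp _ r => r.ClosedStar

/-- All indices (number characters and capturing-group indices) occurring in α are ≤ κ. -/
def Rewb.IdxLe {A : Type} (κ : ℕ) : Rewb A → Prop
  | .ch _ => True
  | .eps => True
  | .backref i => (i : ℕ) ≤ κ
  | .cat r s => r.IdxLe κ ∧ s.IdxLe κ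
  | .alt r s => r.IdxLe κ ∧ s.IdxLe κ
  | .star r => r.IdxLe κ
  | .grp i r => (i : ℕ) ≤ κ ∧ r.IdxLe κ

/-- All indices occurring in a character of Δ are ≤ κ. -/
def RSym.idxLe {A : Type} (κ : ℕ) : RSym A → Prop
  | .ch _ => True
  | .open_ i => (i : ℕ) ≤ κ
  | .close i => (i : ℕ) ≤ κ
  | .ref i => (i : ℕ) ≤ κ

/-! ### The tuple functions φ used in the unary-PMCFG construction -/

/-- The ℕ⁺ index corresponding to `j : Fin κ` (memory cell j+1). -/
def toP {κ : ℕ} (j : Fin κ) : ℕ+ := ⟨j.1 + 1, Nat.succ_pos _⟩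

/-- φ_c^M : the input/paste/reset/identity functions on (κ+1)-tuples of strings. -/
def phi {A : Type} (κ : ℕ) (M : Finset ℕ+) :
    RSym A → (List A × (Fin κ → List A)) → (List A × (Fin κ → List A))
  | RSym.ch a, (x, y) => (x ++ [a], fun j => if toP j ∈ M then y j ++ [a] else y j)
  | RSym.ref k, (x, y) =>
      let yk : List A := if h : k.1 ≤ κ ∧ 1 ≤ k.1 then y ⟨k.1 - 1, by omega⟩ else []
      (x ++ yk, fun j => if toP j ∈ M then y j ++ yk else y j)
  | RSym.open_ k, (x, y) => (x, fun j => if toP j = k then [] else y j)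
  | RSym.close _, t => t

/-- Apply the functions φ_{v_r}^{open(prefix·v₁⋯v_r)} successively, left to right,
where `pref` is the already-processed prefix. -/
noncomputable def derefRun {A : Type} (κ : ℕ) :
    List (RSym A) → List (RSym A) → (List A × (Fin κ → List A)) → (List A × (Fin κ → List A))
  | _, [], t => t
  | pref, c :: rest, t => derefRun κ (pref ++ [c]) rest (phi κ (openSet (pref ++ [c])) c t)

/-! ### The quantities t and s -/

/-- One (right-to-left) step of the t-sequence. -/
def tStep {A : Type} (c : RSym A) (t : ℕ+ → ℕ) : ℕ+ → ℕ :=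
  match c with
  | .ch _ => t
  | .close _ => t
  | .open_ j => fun k => if k = j then 0 else t k
  | .ref j => fun k => if k = j then t k + 1 else t k

/-- `tOf suf k` is t_{i,k} where `suf` is the suffix v_{i+1} ⋯ v_m of v. -/
def tOf {A : Type} : List (RSym A) → ℕ+ → ℕ
  | [] => fun _ => 0
  | c :: rest => tStep c (tOf rest)

/-- One (right-to-left) step of the s-sequence; `O` is open(v₁⋯v_i). -/
def sStep {A : Type} (O : Finset ℕ+) (c : RSym A) (s : ℕ+ → ℕ) : ℕ+ → ℕ :=
  match c with
  | .ch _ => s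
  | .close _ => s
  | .open_ j => fun k => if k = j then 0 else s k
  | .ref j => fun k => if k = j then max (max 1 (s j)) (O.sup fun l => s l + 1) else s k

/-- `sOf pref suf k` is s_{i,k} where v = pref ++ suf and i = |pref|. -/
def sOf {A : Type} : List (RSym A) → List (RSym A) → ℕ+ → ℕ
  | _, [] => fun _ => 0
  | pref, c :: rest => sStep (openSet (pref ++ [c])) c (sOf (pref ++ [c]) rest)

/-! ### Parallel multiple context-free grammars -/

/-- An item of an output component of a PMCFG function: a constant string
or the j-th component of the i-th argument. -/
inductive PItem (T : Type) : Type where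
  | const : List T → PItem T
  | arg : ℕ → ℕ → PItem T

/-- A rule A → f[A₁,…,A_l] of a PMCFG, where f is given syntactically by the
lists of items of its output components. -/
structure PRule (T N : Type) : Type where
  lhs : N
  rhs : List N
  out : List (List (PItem T))

/-- A PMCFG with nonterminals `Fin n`. -/
structure PMCFG (T : Type) : Type where
  n : ℕ
  dim : Fin n → ℕ
  start : Fin n
  rules : List (PRule T (Fin n))

/-- Evaluation of a single item, given the tuples derived from the arguments. -/
def evalItem {T : Type} (args : List (List (List T))) : PItem T → List T
  | .const c => c
  | .arg i j => (args.getD i []).getD j []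

/-- Evaluation of one output component. -/
def evalItems {T : Type} (args : List (List (List T))) (items : List (PItem T)) : List T :=
  (items.map (evalItem args)).flatten

/-- The set L_G(A) of tuples derived from each nonterminal. -/
inductive PMCFG.Derives {T : Type} (G : PMCFG T) : Fin G.n → List (List T) → Prop
  | step (r : PRule T (Fin G.n)) (hr : r ∈ G.rules) (args : List (List (List T)))
      (hargs : List.Forall₂ G.Derives r.rhs args) :
      G.Derives r.lhs (r.out.map (evalItems args))

/-- L(G) = L_G(S), identifying 1-tuples with strings. -/
def PMCFG.lang {T : Type} (G : PMCFG T) : Set (List T) :=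
  {w | G.Derives G.start [w]}

/-- Well-formedness of a rule with respect to the dimension assignment. -/
def PRule.WFdim {T N : Type} (dim : N → ℕ) (r : PRule T N) : Prop :=
  r.out.length = dim r.lhs ∧
  ∀ items ∈ r.out, ∀ it ∈ items, ∀ i j, it = PItem.arg i j →
    ∃ h : i < r.rhs.length, j < dim (r.rhs.get ⟨i, h⟩)

/-- G is a well-formed m-PMCFG. -/
def PMCFG.WF {T : Type} (G : PMCFG T) (m : ℕ) : Prop :=
  (∀ A : Fin G.n, 1 ≤ G.dim A ∧ G.dim A ≤ m) ∧ G.dim G.start = 1 ∧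
  ∀ r ∈ G.rules, r.WFdim G.dim

/-- G is unary: every function takes at most one argument. -/
def PMCFG.Unary {T : Type} (G : PMCFG T) : Prop :=
  ∀ r ∈ G.rules, r.rhs.length ≤ 1

/-- The list of argument components referenced by a rule. -/
def PRule.argRefs {T N : Type} (r : PRule T N) : List (ℕ × ℕ) :=
  r.out.flatten.filterMap fun it => match it with
    | .arg i j => some (i, j)
    | _ => none

/-- G is an MCFG: no rule uses the same argument component more than once. -/
def PMCFG.NonDup {T : Type} (G : PMCFG T) : Prop :=
  ∀ r ∈ G.rules, r.argRefs.Nodup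

/-! ### Stack automata -/

/-- Direction of the stack pointer. -/
inductive SDir : Type where
  | left | stay | right
deriving DecidableEq

/-- A one-way nondeterministic stack automaton.  The input symbol `none`
denotes the endmarker ▷.  `push q a Z` is the pushdown mode (applicable when the
stack pointer is at the top symbol Z; the Bool is whether the input head moves
right); `read q a Z top` is the stack-reading mode (`top` tells whether the
pointed symbol Z is the topmost one). -/
structure SA (T : Type) : Type 1 where
  Q : Type
  finQ : Fintype Q
  Γ : Type
  finΓ : Fintype Γ
  q0 : Q
  Z0 : Γ
  F : Set Q
  push : Q → Option T → Γ → Set (Q × Bool × List Γ)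
  read : Q → Option T → Γ → Bool → Set (Q × Bool × SDir)

namespace SA

/-- Instantaneous description: state, remaining input (the endmarker ▷ is
implicit at the end), stack below-and-including the pointer, stack above the
pointer. -/
def Conf {T : Type} (M : SA T) : Type := M.Q × List T × List M.Γ × List M.Γ

/-- Move the stack pointer: the stack is γ ++ [Z] ++ above with the pointer on Z. -/
def moveStack {Γ : Type} : SDir → List Γ → Γ → List Γ → List Γ × List Γ
  | .left, γ, Z, above => (γ, Z :: above)
  | .stay, γ, Z, above => (γ ++ [Z], above)
  | .right, γ, Z, b :: rest => (γ ++ [Z, b], rest)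
  | .right, γ, Z, [] => (γ ++ [Z], [])

/-- One move of a stack automaton on instantaneous descriptions. -/
inductive Step {T : Type} (M : SA T) : M.Conf → M.Conf → Prop
  | push (q : M.Q) (u : List T) (γ : List M.Γ) (Z : M.Γ) (q' : M.Q) (d : Bool) (y : List M.Γ)
      (hmem : (q', d, y) ∈ M.push q u.head? Z)
      (hd : d = true → u ≠ []) :
      Step M (q, u, γ ++ [Z], []) (q', if d then u.tail else u, γ ++ y, [])
  | read (q : M.Q) (u : List T) (γ : List M.Γ) (Z : M.Γ) (above : List M.Γ)
      (q' : M.Q) (d : Bool) (e : SDir)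
      (hmem : (q', d, e) ∈ M.read q u.head? Z above.isEmpty)
      (hd : d = true → u ≠ [])
      (hleft : e = SDir.left → γ ≠ [])
      (hright : e = SDir.right → above ≠ []) :
      Step M (q, u, γ ++ [Z], above)
        (q', if d then u.tail else u, (moveStack e γ Z above).1, (moveStack e γ Z above).2)

/-- Acceptance: from (q₀, w▷, Z₀↑$) reach a final state with the whole input read. -/
def Accepts {T : Type} (M : SA T) (w : List T) : Prop :=
  ∃ (qf : M.Q) (g1 g2 : List M.Γ), qf ∈ M.F ∧
    Relation.ReflTransGen (Step M) (M.q0, w, [M.Z0], []) (qf, [], g1, g2)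

/-- The language of a stack automaton. -/
def lang {T : Type} (M : SA T) : Set (List T) := {w | M.Accepts w}

/-- Nonerasing: every pushdown-mode transition pushes a nonempty word. -/
def NonErasing {T : Type} (M : SA T) : Prop :=
  ∀ q a Z q' d y, (q', d, y) ∈ M.push q a Z → y ≠ []

end SA

open Classical in
/-- The part of `v` after the last occurrence of `[_i` (all of `v` if there is none). -/
noncomputable def tailAfter {A : Type} (i : ℕ+) (v : List (BSym A)) : List (BSym A) :=
  (v.reverse.takeWhile (fun c => decide (c ≠ BSym.open_ i))).reverse

/-- The group `i` is open at the end of `v`. -/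
def IsOpen {A : Type} (i : ℕ+) (v : List (BSym A)) : Prop :=
  BSym.open_ i ∈ v ∧ BSym.close i ∉ tailAfter i v

theorem tailAfter_open {A : Type} (i : ℕ+) (v : List (BSym A)) :
    tailAfter i (v ++ [BSym.open_ i]) = [] := by
  simp [tailAfter]

theorem tailAfter_of_ne {A : Type} {i : ℕ+} {c : BSym A} (hc : c ≠ BSym.open_ i)
    (v : List (BSym A)) : tailAfter i (v ++ [c]) = tailAfter i v ++ [c] := by
  simp [tailAfter, hc]

open Classical in
theorem fet_eq {A : Type} (i : ℕ+) (v : List (BSym A)) :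
    fet i v = if BSym.open_ i ∈ v then
      projB ((tailAfter i v).takeWhile (fun c => decide (c ≠ BSym.close i))) else [] := by
  unfold fet tailAfter
  congr

@[simp]
theorem projB_append {A : Type} (v w : List (BSym A)) :
    projB (v ++ w) = projB v ++ projB w := by
  simp [projB]

@[simp]
theorem projB_map_ch {A : Type} (w : List A) : projB (w.map BSym.ch) = w := by
  simp [projB]

theorem isOpen_open {A : Type} (i : ℕ+) (v : List (BSym A)) :
    IsOpen i (v ++ [BSym.open_ i]) := by
  simp [IsOpen, tailAfter_open]

theorem isOpen_append_of_ne {A : Type} {i : ℕ+} {c : BSym A} (hc : c ≠ BSym.open_ i)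
    (v : List (BSym A)) : IsOpen i (v ++ [c]) ↔ IsOpen i v ∧ c ≠ BSym.close i := by
  simp only [IsOpen, tailAfter_of_ne hc, List.mem_append, List.mem_singleton, hc.symm,
    or_false, not_or, and_assoc, ne_eq, eq_comm]

theorem fet_open {A : Type} (i : ℕ+) (v : List (BSym A)) :
    fet i (v ++ [BSym.open_ i]) = [] := by
  simp [fet_eq, tailAfter_open, projB]

theorem fet_append_of_isOpen {A : Type} {i : ℕ+} {c : BSym A} (hc : c ≠ BSym.open_ i)
    {v : List (BSym A)} (hv : IsOpen i v) : fet i (v ++ [c]) = fet i v ++ projB [c] := by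
  classical
  have hp : ∀ b ∈ tailAfter i v, decide (b ≠ BSym.close i) = true := by
    intro b hb
    simpa using fun h : b = BSym.close i => hv.2 (h ▸ hb)
  simp only [fet_eq, tailAfter_of_ne hc, List.mem_append, hv.1, true_or, if_true,
    List.takeWhile_append_of_pos hp, projB_append, List.takeWhile_eq_self_iff.2 hp]
  congr 1
  by_cases h : c = BSym.close i <;> simp [h, projB]

theorem takeWhile_append_of_mem {B : Type} {p : B → Bool} {b : B} {l : List B} (hb : b ∈ l)
    (hp : p b = false) (l' : List B) : (l ++ l').takeWhile p = l.takeWhile p := by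
  induction l with
  | nil => simp at hb
  | cons x l ih =>
    rcases List.mem_cons.1 hb with rfl | hb
    · simp [hp]
    · simp [List.takeWhile_cons, ih hb]

theorem fet_append_of_not_isOpen {A : Type} {i : ℕ+} {c : BSym A} (hc : c ≠ BSym.open_ i)
    {v : List (BSym A)} (hv : ¬ IsOpen i v) : fet i (v ++ [c]) = fet i v := by
  classical
  by_cases hm : BSym.open_ i ∈ v
  · have hcl : BSym.close i ∈ tailAfter i v := by
      by_contra h
      exact hv ⟨hm, h⟩
    simp only [fet_eq, tailAfter_of_ne hc, List.mem_append, hm, true_or, if_true]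
    rw [takeWhile_append_of_mem hcl (by simp)]
  · simp [fet_eq, hm, hc.symm]

theorem fet_append_eq_self {A : Type} {i : ℕ+} {c : BSym A} (hc : c ≠ BSym.open_ i)
    (hp : projB [c] = []) (v : List (BSym A)) : fet i (v ++ [c]) = fet i v := by
  by_cases hv : IsOpen i v
  · simp [fet_append_of_isOpen hc hv, hp]
  · exact fet_append_of_not_isOpen hc hv

theorem isOpen_append_map_ch {A : Type} (i : ℕ+) (v : List (BSym A)) (w : List A) :
    IsOpen i (v ++ w.map BSym.ch) ↔ IsOpen i v := by
  induction w using List.reverseRecOn with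
  | nil => simp
  | append_singleton w a ih =>
    rw [List.map_append, ← List.append_assoc, List.map_singleton,
      isOpen_append_of_ne (by simp), ih]
    simp

open Classical in
theorem fet_append_map_ch {A : Type} (i : ℕ+) (v : List (BSym A)) (w : List A) :
    fet i (v ++ w.map BSym.ch) = if IsOpen i v then fet i v ++ w else fet i v := by
  induction w using List.reverseRecOn with
  | nil => simp
  | append_singleton w a ih =>
    rw [List.map_append, ← List.append_assoc, List.map_singleton]
    by_cases hv : IsOpen i v
    · rw [fet_append_of_isOpen (by simp) ((isOpen_append_map_ch i v w).2 hv), ih]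
      simp [hv, projB]
    · rw [fet_append_of_not_isOpen (by simp) (mt (isOpen_append_map_ch i v w).1 hv), ih]
      simp [hv]

theorem preDeref_concat {A : Type} (v : List (RSym A)) (c : RSym A) :
    preDeref (v ++ [c]) = derefStep (preDeref v) c := by
  simp [preDeref]

theorem openSet_concat {A : Type} (v : List (RSym A)) (c : RSym A) :
    openSet (v ++ [c]) = openStep (openSet v) c := by
  simp [openSet]

theorem mem_openSet_iff {A : Type} (i : ℕ+) (v : List (RSym A)) :
    i ∈ openSet v ↔ IsOpen i (preDeref v) := by
  induction v using List.reverseRecOn with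
  | nil => simp [openSet, preDeref, IsOpen]
  | append_singleton v c ih =>
    rw [openSet_concat, preDeref_concat]
    cases c with
    | ch a => simp [openStep, derefStep, isOpen_append_of_ne, ih]
    | open_ j =>
      by_cases h : i = j
      · subst h
        simp [openStep, derefStep, isOpen_open]
      · simp [openStep, derefStep, isOpen_append_of_ne, ih, h, Ne.symm h]
    | close j =>
      simp [openStep, derefStep, isOpen_append_of_ne, ih, eq_comm, and_comm]
    | ref j => simp [openStep, derefStep, isOpen_append_map_ch, ih]

/-- A single step of `phi` computes `deref` and all `mu` of the extended prefix. -/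
theorem phi_deref_mu {A : Type} (κ : ℕ) (v : List (RSym A)) (c : RSym A) (hc : c.idxLe κ) :
    phi κ (openSet (v ++ [c])) c (deref v, fun j : Fin κ => mu (toP j) v) =
      (deref (v ++ [c]), fun j : Fin κ => mu (toP j) (v ++ [c])) := by
  classical
  rw [openSet_concat]
  unfold deref mu
  rw [preDeref_concat]
  cases c with
  | ch a =>
    have h := fun i => fet_append_map_ch i (preDeref v) [a]
    simp only [List.map_singleton] at h
    simp [phi, openStep, derefStep, mem_openSet_iff, h]
    rfl
  | open_ k =>
    refine Prod.ext (by simp [phi, derefStep]; rfl) (funext fun j => ?_)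
    by_cases h : toP j = k
    · subst h
      simp [phi, derefStep, fet_open]
    · simp [phi, derefStep, h, fet_append_eq_self (c := BSym.open_ k)
        (by simpa using Ne.symm h) rfl]
  | close k =>
    refine Prod.ext (by simp [phi, derefStep]; rfl) (funext fun j => ?_)
    simp [phi, derefStep, fet_append_eq_self (c := BSym.close k) (i := toP j) (by simp) rfl]
  | ref k =>
    have hk : k.1 ≤ κ ∧ 1 ≤ k.1 := ⟨hc, k.2⟩
    have hP : toP (⟨k.1 - 1, by omega⟩ : Fin κ) = k := PNat.eq (Nat.sub_add_cancel k.2)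
    simp only [phi, openStep, derefStep, dif_pos hk, hP, mem_openSet_iff, fet_append_map_ch,
      projB_append, projB_map_ch]

theorem derefRun_deref_mu {A : Type} (κ : ℕ) (w pre : List (RSym A))
    (hw : ∀ c ∈ w, c.idxLe κ) :
    derefRun κ pre w (deref pre, fun j : Fin κ => mu (toP j) pre) =
      (deref (pre ++ w), fun j : Fin κ => mu (toP j) (pre ++ w)) := by
  induction w generalizing pre with
  | nil => simp [derefRun]
  | cons c w ih =>
    rw [derefRun, phi_deref_mu κ pre c (hw c (by simp)),
      ih _ fun d hd => hw d (List.mem_cons_of_mem _ hd)]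
    simp

theorem idxLe_of_mem_Ref {A : Type} {κ : ℕ} {α : Rewb A} (hκ : α.IdxLe κ) :
    ∀ v ∈ Ref α, ∀ c ∈ v, c.idxLe κ := by
  induction α with
  | ch a =>
    rintro v rfl c hc
    obtain rfl := List.mem_singleton.1 hc
    trivial
  | eps =>
    rintro v rfl c hc
    simp at hc
  | backref i =>
    rintro v rfl c hc
    obtain rfl := List.mem_singleton.1 hc
    exact hκ
  | cat r s ihr ihs =>
    intro v hv c hc
    obtain ⟨x, hx, y, hy, rfl⟩ := Language.mem_mul.1 hv
    rcases List.mem_append.1 hc with h | h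
    · exact ihr hκ.1 x hx c h
    · exact ihs hκ.2 y hy c h
  | alt r s ihr ihs =>
    rintro v (hv | hv)
    · exact ihr hκ.1 v hv
    · exact ihs hκ.2 v hv
  | star r ih =>
    intro v hv c hc
    obtain ⟨L, rfl, hL⟩ := Language.mem_kstar.1 hv
    obtain ⟨x, hx, h⟩ := List.mem_flatten.1 hc
    exact ih hκ x (hL x hx) c h
  | grp i r ih =>
    intro v hv c hc
    obtain ⟨xy, hxy, z, rfl, rfl⟩ := Language.mem_mul.1 hv
    obtain ⟨x, rfl, y, hy, rfl⟩ := Language.mem_mul.1 hxy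
    rcases List.mem_append.1 hc with h | h
    · rcases List.mem_append.1 h with h | h
      · obtain rfl := List.mem_singleton.1 h
        exact hκ.1
      · exact ih hκ.2 y hy c h
    · obtain rfl := List.mem_singleton.1 h
      exact hκ.1

/-- Lemma base. -/
theorem stmt7 {A : Type} (κ : ℕ) (α : Rewb A) (hwf : α.WF) (hκ : α.IdxLe κ)
    (v : List (RSym A)) (hv : v ∈ Ref α) :
    ∀ i ≤ v.length,
      derefRun κ [] (v.take i) ([], fun _ => []) =
        (deref (v.take i), fun j : Fin κ => mu (toP j) (v.take i)) := by
  intro i _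
  simpa [deref, mu, preDeref, projB, fet] using derefRun_deref_mu κ (v.take i) []
    fun c hc => idxLe_of_mem_Ref hκ v hv c (List.mem_of_mem_take hc)

end Rewbs
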